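/- For every integer N ≥ 1, every planar link pattern β ∈ LP_N, and all integers 1 ≤ k_1 < k_2 < ⋯ < k_N ≤ 2N−1, the coefficient c_β(k_1,…,k_N) equals 0 or 1; in particular it is a real number. -/

import Mathlib

open MeasureTheory

/-- A planar link pattern of size `N`: a noncrossing perfect matching of `{1,…,2N}`,
with the links `{a r, b r}` satisfying `a r < b r` and `a` strictly increasing. -/
structure LinkPattern (N : ℕ) where
  a : Fin N → ℕ
  b : Fin N → ℕ
  a_lt_b : ∀ r, a r < b r
  a_mono : StrictMono a
  inj : Function.Injective (fun p : Fin N × Bool => if p.2 then b p.1 else a p.1)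
  cover : ∀ k : ℕ, (∃ p : Fin N × Bool, (if p.2 then b p.1 else a p.1) = k) ↔ (1 ≤ k ∧ k ≤ 2 * N)
  noncross : ∀ r s : Fin N, ¬ (a r < a s ∧ a s < b r ∧ b r < b s)

/-- The (unordered) link relation of a link pattern. -/
def LinkPattern.Linked {N : ℕ} (β : LinkPattern N) (p q : ℕ) : Prop :=
  ∃ r, (β.a r = p ∧ β.b r = q) ∨ (β.a r = q ∧ β.b r = p)

/-- The positive real integral `ρ_{k_1,…,k_N}(x)`. -/
noncomputable def rho (N : ℕ) (k : Fin N → ℕ) (x : ℕ → ℝ) : ℝ :=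
  (∏ p ∈ (Finset.Icc 1 (2 * N) ×ˢ Finset.Icc 1 (2 * N)).filter fun p => p.1 < p.2,
      (x p.2 - x p.1) ^ ((4 : ℝ)⁻¹)) *
  ∫ u : Fin N → ℝ in Set.univ.pi fun r => Set.Ioo (x (k r)) (x (k r + 1)),
    (∏ p ∈ (Finset.univ ×ˢ Finset.univ : Finset (Fin N × Fin N)).filter fun p => p.1 < p.2,
        (u p.2 - u p.1)) *
      ∏ r, ∏ i ∈ Finset.Icc 1 (2 * N), |u r - x i| ^ (-(2 : ℝ)⁻¹)

/-- The coefficient `c_β(k_1,…,k_N)`. -/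
noncomputable def linkCoeff (N : ℕ) (β : LinkPattern N) (k : Fin N → ℕ) : ℂ :=
  Complex.I ^ ((∑ r, (k r : ℤ)) - ∑ r, (β.a r : ℤ)) *
    ∑ σ : Equiv.Perm (Fin N),
      ((Equiv.Perm.sign σ : ℤ) : ℂ) *
        ∏ r, if β.a r ≤ k (σ r) ∧ k (σ r) < β.b r then (1 : ℂ) else 0

/-- The Coulomb gas integral `F_β(x)`. -/
noncomputable def coulomb (N : ℕ) (β : LinkPattern N) (x : ℕ → ℝ) : ℂ :=
  ∑ k ∈ (Fintype.piFinset fun _ : Fin N => Finset.Icc 1 (2 * N - 1)).filter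
      fun k => ∀ r s : Fin N, r < s → k r < k s,
    linkCoeff N β k * (rho N k x : ℂ)

/-- Membership in the open chamber `𝔛_{2N}` (only coordinates `1,…,2N` are relevant). -/
def IsChamber (N : ℕ) (x : ℕ → ℝ) : Prop :=
  ∀ i k : ℕ, 1 ≤ i → i < k → k ≤ 2 * N → x i < x k

namespace LinkPattern

variable {N : ℕ} (β : LinkPattern N)

/-- The link `r` is the innermost link whose interval `[a r, b r)` contains `m`. -/
def IsInnermost (m : ℕ) (r : Fin N) : Prop :=
  (β.a r ≤ m ∧ m < β.b r) ∧ ∀ j, β.a j ≤ m → m < β.b j → j ≤ r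

theorem exists_isInnermost {m : ℕ} {r : Fin N} (h : β.a r ≤ m ∧ m < β.b r) :
    ∃ j, β.IsInnermost m j := by
  obtain ⟨j, hj, hmax⟩ := (Finset.univ.filter fun j => β.a j ≤ m ∧ m < β.b j).exists_max_image id
    ⟨r, by simpa using h⟩
  exact ⟨j, by simpa using hj, fun i hi hi' => hmax i (by simp [hi, hi'])⟩

theorem a_injective : Function.Injective β.a := β.a_mono.injective

theorem b_injective : Function.Injective β.b := fun r s h => by
  simpa using β.inj (a₁ := (r, true)) (a₂ := (s, true)) (by simpa using h)

theorem a_ne_b (r s : Fin N) : β.a r ≠ β.b s := fun h => by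
  simpa using β.inj (a₁ := (r, false)) (a₂ := (s, true)) (by simpa using h)

theorem IsInnermost.mem_iff {m : ℕ} {j : Fin N} (h : β.IsInnermost m j) (r : Fin N) :
    (β.a r ≤ m ∧ m < β.b r) ↔ (β.a r ≤ β.a j ∧ β.b j ≤ β.b r) := by
  obtain ⟨⟨h1, h2⟩, h3⟩ := h
  refine ⟨fun ⟨hr1, hr2⟩ => ?_, fun ⟨hr1, hr2⟩ => ⟨by omega, by omega⟩⟩
  have hle := β.a_mono.monotone (h3 r hr1 hr2)
  refine ⟨hle, ?_⟩
  rcases hle.eq_or_lt with he | hlt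
  · rw [β.a_injective he]
  · have := β.noncross r j
    omega

/-- If `m` lies directly under the link `r`, then the links opened in `(a r, m]` are closed there,
and their endpoints exhaust this interval. -/
theorem IsInnermost.sub_eq_two_mul_card {m : ℕ} {r : Fin N} (h : β.IsInnermost m r)
    (hm : m ≤ 2 * N) :
    m - β.a r = 2 * (Finset.univ.filter fun j => β.a r < β.a j ∧ β.a j ≤ m).card := by
  obtain ⟨⟨h1, h2⟩, h3⟩ := h
  set J := Finset.univ.filter fun j => β.a r < β.a j ∧ β.a j ≤ m with hJ
  have hclosed : ∀ j, β.a r < β.a j → β.a j ≤ m → β.b j ≤ m := fun j hj hj' => by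
    by_contra! hlt
    exact (β.a_mono.monotone (h3 j hj' hlt)).not_gt hj
  have hunion : Finset.Ioc (β.a r) m = J.image β.a ∪ J.image β.b := by
    ext p
    simp only [Finset.mem_Ioc, Finset.mem_union, Finset.mem_image, hJ, Finset.mem_filter,
      Finset.mem_univ, true_and]
    constructor
    · rintro ⟨hp1, hp2⟩
      obtain ⟨⟨j, c⟩, hjc⟩ := (β.cover p).2 ⟨by omega, by omega⟩
      cases c
      · simp only [Bool.false_eq_true, if_false] at hjc
        exact Or.inl ⟨j, ⟨by omega, by omega⟩, hjc⟩
      · simp only [if_true] at hjc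
        have hab := β.a_lt_b j
        have hne : β.a j ≠ β.a r := fun he => by
          rw [β.a_injective he] at hjc
          omega
        have := β.noncross j r
        have := β.a_ne_b r j
        exact Or.inr ⟨j, ⟨by omega, by omega⟩, hjc⟩
    · rintro (⟨j, hj, rfl⟩ | ⟨j, hj, rfl⟩)
      · exact hj
      · exact ⟨hj.1.trans (β.a_lt_b j), hclosed j hj.1 hj.2⟩
  have hdisj : Disjoint (J.image β.a) (J.image β.b) := by
    rw [Finset.disjoint_left]
    intro p hp hp'
    obtain ⟨i, -, hi⟩ := Finset.mem_image.1 hp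
    obtain ⟨j, -, hj⟩ := Finset.mem_image.1 hp'
    exact β.a_ne_b i j (hi.trans hj.symm)
  rw [← Nat.card_Ioc, hunion, Finset.card_union_of_disjoint hdisj,
    Finset.card_image_of_injective _ β.a_injective, Finset.card_image_of_injective _ β.b_injective,
    two_mul]

/-- The incidence matrix of nesting: the link `j` lies weakly inside the link `r`. -/
noncomputable def nesting : Matrix (Fin N) (Fin N) ℂ :=
  Matrix.of fun j r => if β.a r ≤ β.a j ∧ β.b j ≤ β.b r then 1 else 0

theorem det_nesting : β.nesting.det = 1 := by
  rw [Matrix.det_of_isLowerTriangular]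
  · simp [nesting]
  · intro j r hjr
    have : β.a j < β.a r := β.a_mono hjr
    simp [nesting, this]

/-- The matrix of incidences between the points `k s` and the intervals `[a r, b r)`. -/
noncomputable def incidence (k : Fin N → ℕ) : Matrix (Fin N) (Fin N) ℂ :=
  Matrix.of fun s r => if β.a r ≤ k s ∧ k s < β.b r then 1 else 0

theorem incidence_row {k : Fin N → ℕ} {s j : Fin N} (h : β.IsInnermost (k s) j) :
    β.incidence k s = β.nesting j := by
  ext r
  simp [incidence, nesting, h.mem_iff]

theorem sum_sub_sum_eq {k : Fin N → ℕ} (hk : StrictMono k) (hk2 : ∀ s, k s ≤ 2 * N)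
    {f : Equiv.Perm (Fin N)} (hf : ∀ s, β.IsInnermost (k s) (f s)) :
    (∑ s, (k s : ℤ)) - ∑ r, (β.a r : ℤ) =
      2 * ((∑ s, ((Finset.Iio s).filter fun t => ¬ f t < f s).card : ℕ) : ℤ) := by
  rw [← Equiv.sum_comp f fun r => (β.a r : ℤ), ← Finset.sum_sub_distrib, Nat.cast_sum,
    Finset.mul_sum]
  refine Finset.sum_congr rfl fun s _ => ?_
  have hcard : (Finset.univ.filter fun j => β.a (f s) < β.a j ∧ β.a j ≤ k s) =
      ((Finset.Iio s).filter fun t => ¬ f t < f s).map f.toEmbedding := by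
    ext j
    obtain ⟨t, rfl⟩ := f.surjective j
    obtain ⟨⟨ht1, ht2⟩, -⟩ := hf t
    have hs := (hf s).2 (f t)
    simp only [Finset.mem_filter, Finset.mem_univ, true_and, Finset.mem_map_equiv,
      Equiv.symm_apply_apply, Finset.mem_Iio, not_lt, β.a_mono.lt_iff_lt]
    constructor
    · rintro ⟨hlt, hle⟩
      have hb : β.b (f t) ≤ k s := by
        by_contra! hb
        exact (hs hle hb).not_gt hlt
      exact ⟨hk.lt_iff_lt.1 (ht2.trans_le hb), hlt.le⟩
    · rintro ⟨hlt, hle⟩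
      exact ⟨hle.lt_of_ne fun he => hlt.ne (f.injective he).symm, ht1.trans (hk hlt).le⟩
  have h1 := (hf s).sub_eq_two_mul_card _ (hk2 s)
  have h2 := (hf s).1.1
  rw [hcard, Finset.card_map] at h1
  omega

end LinkPattern

theorem sign_eq_neg_one_pow_sum_card {N : ℕ} (f : Equiv.Perm (Fin N)) :
    Equiv.Perm.sign f =
      (-1) ^ ∑ s, ((Finset.Iio s).filter fun t => ¬ f t < f s).card := by
  rw [f.sign_eq_prod_prod_Iio, ← Finset.prod_pow_eq_pow_sum]
  exact Finset.prod_congr rfl fun s _ => by simp [Finset.prod_ite]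

theorem linkCoeff_eq_mul_det (N : ℕ) (β : LinkPattern N) (k : Fin N → ℕ) :
    linkCoeff N β k =
      Complex.I ^ ((∑ r, (k r : ℤ)) - ∑ r, (β.a r : ℤ)) * (β.incidence k).det := by
  rw [Matrix.det_apply', linkCoeff]
  rfl

/-- **The coefficients `c_β(k₁,…,k_N)` equal `0` or `1`**; in particular they are real. -/
theorem linkCoeff_eq_zero_or_one (N : ℕ) (hN : 1 ≤ N) (β : LinkPattern N) (k : Fin N → ℕ)
    (hk1 : ∀ r, 1 ≤ k r) (hk2 : ∀ r, k r ≤ 2 * N - 1)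
    (hkmono : ∀ r s : Fin N, r < s → k r < k s) :
    linkCoeff N β k = 0 ∨ linkCoeff N β k = 1 := by
  have hk : StrictMono k := fun r s h => hkmono r s h
  rw [linkCoeff_eq_mul_det]
  by_cases hex : ∀ s, ∃ j, β.IsInnermost (k s) j
  · choose f hf using hex
    by_cases hinj : Function.Injective f
    · right
      obtain ⟨g, rfl⟩ : ∃ g : Equiv.Perm (Fin N), ⇑g = f :=
        ⟨Equiv.ofBijective f (Finite.injective_iff_bijective.1 hinj), rfl⟩
      have hmat : β.incidence k = β.nesting.submatrix g id :=
        funext fun s => β.incidence_row (hf s)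
      rw [hmat, Matrix.det_permute, β.det_nesting,
        β.sum_sub_sum_eq hk (fun s => (hk2 s).trans (Nat.sub_le _ _)) hf,
        sign_eq_neg_one_pow_sum_card, zpow_mul, zpow_natCast]
      norm_num [← mul_pow]
    · left
      obtain ⟨s, t, hst, hne⟩ := Function.not_injective_iff.1 hinj
      rw [Matrix.det_zero_of_row_eq hne, mul_zero]
      rw [β.incidence_row (hf s), β.incidence_row (hf t), hst]
  · left
    push Not at hex
    obtain ⟨s, hs⟩ := hex
    rw [Matrix.det_eq_zero_of_row_eq_zero s, mul_zero]
    intro r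
    refine if_neg fun h => ?_
    obtain ⟨j, hj⟩ := β.exists_isInnermost h
    exact hs j hj
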